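/- arXiv:1110.5977 — 2 statements merged into one kernel-verified Lean document; each statement's English description precedes it below -/
import Mathlib

section
/- Let M be an equivelar map of Schläfli type {p,q} and let A be a face of M. Let n be the number of Γ(M)-orbits on flags that contain at least one flag belonging to A. Then n divides 2p; moreover, if some flag Φ belonging to A satisfies σ0Φ ∈ Γ(M)·Φ or σ1Φ ∈ Γ(M)·Φ, then n divides p. -/
/-- A map: a finite nonempty set of flags with three fixed-point-free involutions
`s0, s1, s2` such that `s0 * s2` is also a fixed-point-free involution and the
group generated by them acts transitively on the flags. -/
structure CMap (F : Type) [Fintype F] where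
  nonempty : Nonempty F
  s0 : Equiv.Perm F
  s1 : Equiv.Perm F
  s2 : Equiv.Perm F
  invol0 : s0 * s0 = 1
  invol1 : s1 * s1 = 1
  invol2 : s2 * s2 = 1
  fpf0 : ∀ x, s0 x ≠ x
  fpf1 : ∀ x, s1 x ≠ x
  fpf2 : ∀ x, s2 x ≠ x
  invol02 : (s0 * s2) * (s0 * s2) = 1
  fpf02 : ∀ x, s0 (s2 x) ≠ x
  conn : ∀ x y : F, ∃ g ∈ Subgroup.closure ({s0, s1, s2} : Set (Equiv.Perm F)), g x = y

namespace CMap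

variable {F : Type} [Fintype F]

/-- The automorphism group of a map: all permutations of the flags commuting
with each of `s0, s1, s2`. -/
def aut (M : CMap F) : Subgroup (Equiv.Perm F) :=
  Subgroup.centralizer {M.s0, M.s1, M.s2}

/-- The vertex containing a flag `x`: the orbit of `x` under `⟨s1, s2⟩`. -/
def vertexOf (M : CMap F) (x : F) : Set F :=
  MulAction.orbit (Subgroup.closure ({M.s1, M.s2} : Set (Equiv.Perm F))) x

/-- The edge containing a flag `x`: the orbit of `x` under `⟨s0, s2⟩`. -/
def edgeOf (M : CMap F) (x : F) : Set F :=
  MulAction.orbit (Subgroup.closure ({M.s0, M.s2} : Set (Equiv.Perm F))) x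

/-- The face containing a flag `x`: the orbit of `x` under `⟨s0, s1⟩`. -/
def faceOf (M : CMap F) (x : F) : Set F :=
  MulAction.orbit (Subgroup.closure ({M.s0, M.s1} : Set (Equiv.Perm F))) x

/-- The orbit of a flag under the automorphism group. -/
def flagOrbit (M : CMap F) (x : F) : Set F :=
  MulAction.orbit M.aut x

noncomputable def numVertices (M : CMap F) : ℕ := Nat.card (Set.range M.vertexOf)

noncomputable def numEdges (M : CMap F) : ℕ := Nat.card (Set.range M.edgeOf)

noncomputable def numFaces (M : CMap F) : ℕ := Nat.card (Set.range M.faceOf)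

/-- The Euler characteristic `V - E + F` of a map. -/
noncomputable def euler (M : CMap F) : ℤ :=
  (M.numVertices : ℤ) - (M.numEdges : ℤ) + (M.numFaces : ℤ)

/-- The number of orbits of the automorphism group on flags. -/
noncomputable def numFlagOrbits (M : CMap F) : ℕ := Nat.card (Set.range M.flagOrbit)

/-- `M` is a `k`-orbit map if its automorphism group has exactly `k` orbits on flags. -/
def IsKOrbit (M : CMap F) (k : ℕ) : Prop := M.numFlagOrbits = k

/-- A map is regular if it is a 1-orbit map. -/
def IsRegular (M : CMap F) : Prop := M.IsKOrbit 1

/-- A map is chiral if it is a 2-orbit map in which every flag lies in a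
different automorphism orbit from each of its images under `s0, s1, s2`. -/
def IsChiral (M : CMap F) : Prop :=
  M.IsKOrbit 2 ∧ ∀ x : F,
    M.s0 x ∉ M.flagOrbit x ∧ M.s1 x ∉ M.flagOrbit x ∧ M.s2 x ∉ M.flagOrbit x

/-- A map is vertex-transitive if its automorphism group acts transitively on vertices. -/
def VertexTransitive (M : CMap F) : Prop :=
  ∀ x y : F, ∃ g ∈ M.aut, M.vertexOf (g x) = M.vertexOf y

/-- A map is edge-transitive if its automorphism group acts transitively on edges. -/
def EdgeTransitive (M : CMap F) : Prop :=
  ∀ x y : F, ∃ g ∈ M.aut, M.edgeOf (g x) = M.edgeOf y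

/-- `M` is equivelar of Schläfli type `{p, q}`: every face has exactly `2p` flags
and every vertex has exactly `2q` flags. -/
def Equivelar (M : CMap F) (p q : ℕ) : Prop :=
  (∀ x : F, Nat.card (M.faceOf x) = 2 * p) ∧
  (∀ x : F, Nat.card (M.vertexOf x) = 2 * q)

/-- A map is orientable if the flags can be partitioned into two classes so that
each of `s0, s1, s2` maps each class into the other. -/
def Orientable (M : CMap F) : Prop :=
  ∃ A : Set F,
    (∀ x, M.s0 x ∈ A ↔ x ∉ A) ∧ (∀ x, M.s1 x ∈ A ↔ x ∉ A) ∧ (∀ x, M.s2 x ∈ A ↔ x ∉ A)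

end CMap

/-- Two maps are isomorphic if there is a bijection between their flag sets
commuting with the respective involutions. -/
def CMap.Isomorphic {F F' : Type} [Fintype F] [Fintype F'] (M : CMap F) (N : CMap F') : Prop :=
  ∃ e : F ≃ F',
    (∀ x, e (M.s0 x) = N.s0 (e x)) ∧ (∀ x, e (M.s1 x) = N.s1 (e x)) ∧
    (∀ x, e (M.s2 x) = N.s2 (e x))

namespace CMap

variable {F : Type} [Fintype F] (M : CMap F)

theorem closure_le_centralizer_aut :
    Subgroup.closure {M.s0, M.s1} ≤ Subgroup.centralizer (M.aut : Set (Equiv.Perm F)) := by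
  rw [Subgroup.closure_le]
  intro d hd
  rw [SetLike.mem_coe, Subgroup.mem_centralizer_iff]
  intro g hg
  refine (Subgroup.mem_centralizer_iff.mp hg d ?_).symm
  rcases hd with rfl | rfl <;> simp

theorem flagOrbit_eq_iff {x y : F} : M.flagOrbit x = M.flagOrbit y ↔ x ∈ M.flagOrbit y :=
  MulAction.orbit_eq_iff

/-- A permutation commuting with all automorphisms permutes the flag orbits. -/
theorem flagOrbit_apply {d : Equiv.Perm F}
    (hd : d ∈ Subgroup.centralizer (M.aut : Set (Equiv.Perm F))) (x : F) :
    M.flagOrbit (d x) = d '' M.flagOrbit x := by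
  have hcomm (g : M.aut) : g • d x = d (g • x) :=
    congrArg (fun e : Equiv.Perm F ↦ e x) (Subgroup.mem_centralizer_iff.mp hd g g.2)
  ext y
  constructor
  · rintro ⟨g, rfl⟩
    exact ⟨g • x, ⟨g, rfl⟩, (hcomm g).symm⟩
  · rintro ⟨_, ⟨g, rfl⟩, rfl⟩
    exact ⟨g, hcomm g⟩

theorem flagOrbit_apply_eq_iff {d : Equiv.Perm F}
    (hd : d ∈ Subgroup.centralizer (M.aut : Set (Equiv.Perm F))) {x y : F} :
    M.flagOrbit (d x) = M.flagOrbit (d y) ↔ M.flagOrbit x = M.flagOrbit y := by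
  rw [M.flagOrbit_apply hd, M.flagOrbit_apply hd, d.injective.image_injective.eq_iff]

theorem apply_mem_faceOf {d : Equiv.Perm F} (hd : d ∈ Subgroup.closure {M.s0, M.s1}) {x₀ x : F} :
    d x ∈ M.faceOf x₀ ↔ x ∈ M.faceOf x₀ := by
  have horbit := MulAction.orbit_smul (⟨d, hd⟩ : Subgroup.closure {M.s0, M.s1}) x
  rw [faceOf, ← MulAction.orbit_eq_iff, ← MulAction.orbit_eq_iff]
  exact Eq.congr_left horbit

/-- Flag orbits meeting a face all meet it in the same number of flags. -/
theorem card_image_flagOrbit_mul_ncard {x₀ x : F} (hx : x ∈ M.faceOf x₀) :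
    Nat.card (M.flagOrbit '' M.faceOf x₀) *
      {y ∈ M.faceOf x₀ | M.flagOrbit y = M.flagOrbit x}.ncard = Nat.card (M.faceOf x₀) := by
  classical
  have hfib : ∀ z ∈ M.faceOf x₀, {y ∈ M.faceOf x₀ | M.flagOrbit y = M.flagOrbit z}.ncard =
      {y ∈ M.faceOf x₀ | M.flagOrbit y = M.flagOrbit x}.ncard := by
    intro z hz
    obtain ⟨⟨d, hd⟩, rfl⟩ : z ∈ M.faceOf x := by
      rw [faceOf, MulAction.orbit_eq_iff.mpr hx]
      exact hz
    refine (Set.ncard_congr (fun y _ ↦ d y) ?_ (fun _ _ _ _ h ↦ d.injective h) ?_).symm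
    · rintro y ⟨hy, hyx⟩
      exact ⟨(M.apply_mem_faceOf hd).mpr hy,
        (M.flagOrbit_apply_eq_iff (M.closure_le_centralizer_aut hd)).mpr hyx⟩
    · rintro y ⟨hy, hyx⟩
      obtain ⟨w, rfl⟩ := d.surjective y
      exact ⟨w, ⟨(M.apply_mem_faceOf hd).mp hy,
        (M.flagOrbit_apply_eq_iff (M.closure_le_centralizer_aut hd)).mp hyx⟩, rfl⟩
  have hsum := Finset.card_eq_sum_card_image M.flagOrbit (M.faceOf x₀).toFinset
  rw [Finset.sum_const_nat (m := {y ∈ M.faceOf x₀ | M.flagOrbit y = M.flagOrbit x}.ncard)] at hsum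
  · rw [Nat.card_coe_set_eq, Nat.card_coe_set_eq, Set.ncard_eq_toFinset_card' (M.faceOf x₀), hsum,
      ← Set.ncard_coe_finset, Finset.coe_image, Set.coe_toFinset]
  · intro b hb
    obtain ⟨z, hz, rfl⟩ := Finset.mem_image.mp hb
    rw [← hfib z (Set.mem_toFinset.mp hz), ← Set.ncard_coe_finset]
    simp

end CMap

theorem Set.even_ncard_of_involutive {α : Type*} {s : Set α} (hs : s.Finite) {f : α → α}
    (hf : Function.Involutive f) (hfix : ∀ a, f a ≠ a) (hmaps : Set.MapsTo f s s) :
    Even s.ncard := by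
  have hzero : ∑ _a ∈ hs.toFinset, (1 : ZMod 2) = 0 :=
    Finset.sum_involution (fun a _ ↦ f a) (fun _ _ ↦ by decide) (fun a _ _ ↦ hfix a)
      (fun a ha ↦ hs.mem_toFinset.mpr (hmaps (hs.mem_toFinset.mp ha))) (fun a _ ↦ hf a)
  rw [Finset.sum_const, nsmul_one, ZMod.natCast_eq_zero_iff_even] at hzero
  rwa [Set.ncard_eq_toFinset_card s hs]

namespace CMap

variable {F : Type} [Fintype F] (M : CMap F)

theorem even_ncard_of_apply_mem_flagOrbit {d : Equiv.Perm F}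
    (hd : d ∈ Subgroup.closure {M.s0, M.s1}) (hinv : d * d = 1) (hfix : ∀ x, d x ≠ x)
    {x₀ x : F} (hx : d x ∈ M.flagOrbit x) :
    Even {y ∈ M.faceOf x₀ | M.flagOrbit y = M.flagOrbit x}.ncard := by
  refine Set.even_ncard_of_involutive (Set.toFinite _) (f := d)
    (fun y ↦ congrArg (fun e : Equiv.Perm F ↦ e y) hinv) hfix ?_
  rintro y ⟨hy, hyx⟩
  exact ⟨(M.apply_mem_faceOf hd).mpr hy,
    ((M.flagOrbit_apply_eq_iff (M.closure_le_centralizer_aut hd)).mpr hyx).trans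
      (M.flagOrbit_eq_iff.mpr hx)⟩

end CMap

/-- In an equivelar map of type `{p, q}`, the number `n` of
automorphism orbits on flags meeting a given face `A` divides `2p`; if moreover
some flag `Φ` of `A` has `σ₀Φ` or `σ₁Φ` in the orbit of `Φ`, then `n` divides `p`. -/
theorem stmt_1 {F : Type} [Fintype F] (M : CMap F) (p q : ℕ)
    (heq : M.Equivelar p q) (x0 : F) (A : Set F) (hA : A = M.faceOf x0)
    (n : ℕ) (hn : n = Nat.card (M.flagOrbit '' A)) :
    n ∣ 2 * p ∧
      ((∃ Φ ∈ A, M.s0 Φ ∈ M.flagOrbit Φ ∨ M.s1 Φ ∈ M.flagOrbit Φ) → n ∣ p) := by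
  subst hA hn
  have hcard {x : F} (hx : x ∈ M.faceOf x0) :=
    (M.card_image_flagOrbit_mul_ncard hx).trans (heq.1 x0)
  refine ⟨Dvd.intro _ (hcard (MulAction.mem_orbit_self x0)), ?_⟩
  rintro ⟨Φ, hΦ, hmem⟩
  have heven : Even {y ∈ M.faceOf x0 | M.flagOrbit y = M.flagOrbit Φ}.ncard := by
    rcases hmem with h | h
    · exact M.even_ncard_of_apply_mem_flagOrbit (Subgroup.subset_closure (by simp))
        M.invol0 M.fpf0 h
    · exact M.even_ncard_of_apply_mem_flagOrbit (Subgroup.subset_closure (by simp))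
        M.invol1 M.fpf1 h
  obtain ⟨k, hk⟩ := heven
  have hmul := hcard hΦ
  rw [hk, ← two_mul, mul_left_comm] at hmul
  exact Dvd.intro k (Nat.eq_of_mul_eq_mul_left two_pos hmul)
end

section
/- There is no vertex-transitive equivelar map of Schläfli type {3,7} that is a 7-orbit map. -/
section Involutions

open Equiv

variable {α : Type*}

/-- A set stable under a set of involutions is stable under the group they generate. -/
theorem apply_mem_of_mem_closure {K : Set (Perm α)} {S : Set α}
    (hK : ∀ k ∈ K, k * k = 1) (hS : ∀ k ∈ K, ∀ y ∈ S, k y ∈ S)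
    {g : Perm α} (hg : g ∈ Subgroup.closure K) {x : α} (hx : x ∈ S) : g x ∈ S := by
  suffices h : ∀ y, g y ∈ S ↔ y ∈ S from (h x).2 hx
  induction hg using Subgroup.closure_induction with
  | mem k hk =>
    refine fun y => ⟨fun h => ?_, hS k hk y⟩
    have h' := hS k hk _ h
    rwa [← Perm.mul_apply, hK k hk] at h'
  | one => simp
  | mul g h _ _ hg hh => intro y; rw [Perm.mul_apply, hg, hh]
  | inv g _ hg => intro y; rw [← hg, Perm.inv_def, Equiv.apply_symm_apply]

variable {a b : Perm α}

theorem left_apply_zpow_mul (ha : a * a = 1) (hb : b * b = 1) (i : ℤ) (x : α) :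
    a (((a * b) ^ i) x) = ((a * b) ^ (-i)) (a x) := by
  have h : a * (a * b) * a⁻¹ = (a * b)⁻¹ := by
    rw [mul_inv_rev, ← mul_assoc, ha, one_mul, ← eq_inv_of_mul_eq_one_left hb]
  have h' : a * (a * b) ^ i = (a * b) ^ (-i) * a := by
    rw [zpow_neg, ← inv_zpow, ← h, conj_zpow, inv_mul_cancel_right]
  exact congrArg (fun g : Perm α => g x) h'

theorem right_apply_zpow_mul (ha : a * a = 1) (hb : b * b = 1) (i : ℤ) (x : α) :
    b (((a * b) ^ i) x) = ((a * b) ^ (-i)) (b x) := by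
  have h : b = a * (a * b) := by rw [← mul_assoc, ha, one_mul]
  have h1 : b (((a * b) ^ i) x) = a (((a * b) ^ (1 + i)) x) := by
    rw [zpow_one_add, ← Perm.mul_apply, ← Perm.mul_apply, ← mul_assoc, ← h]
  have h2 : a x = (a * b) (b x) := by
    rw [← Perm.mul_apply, mul_assoc, hb, mul_one]
  rw [h1, left_apply_zpow_mul ha hb, h2, ← Perm.mul_apply, ← zpow_add_one]
  congr 2
  ring

theorem card_orbit_zpowers [Finite α] (t : Perm α) (x : α) :
    (Set.range fun i : ℤ => (t ^ i) x).ncard = Function.minimalPeriod t x := by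
  have h : (Set.range fun i : ℤ => (t ^ i) x) = MulAction.orbit (Subgroup.zpowers t) x := by
    ext y
    constructor
    · rintro ⟨i, rfl⟩
      exact ⟨⟨t ^ i, i, rfl⟩, rfl⟩
    · rintro ⟨⟨_, i, rfl⟩, rfl⟩
      exact ⟨i, rfl⟩
  have := Fintype.ofFinite (MulAction.orbit (Subgroup.zpowers t) x)
  rw [h, ← Nat.card_coe_set_eq, Nat.card_eq_fintype_card, ← MulAction.minimalPeriod_eq_card]
  rfl

theorem zpow_apply_eq_iff (t : Perm α) (x : α) (i j : ℤ) :
    (t ^ i) x = (t ^ j) x ↔ (Function.minimalPeriod t x : ℤ) ∣ i - j := by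
  have h := MulAction.zpow_smul_eq_iff_minimalPeriod_dvd (a := t) (b := x) (n := i - j)
  rw [Perm.smul_def] at h
  refine Iff.trans ?_ h
  rw [sub_eq_neg_add, zpow_add, Perm.mul_apply, zpow_neg, Perm.inv_eq_iff_eq]

/-- If two fixed-point-free involutions generate a group with an orbit of size `2 * p`, their
product has order dividing `p` on that orbit. -/
theorem mul_pow_apply_eq_self [Finite α] (ha : a * a = 1) (hb : b * b = 1)
    (ha' : ∀ x, a x ≠ x) (hb' : ∀ x, b x ≠ x) {x : α} {p : ℕ}
    (hp : Nat.card (MulAction.orbit (Subgroup.closure ({a, b} : Set (Perm α))) x) = 2 * p) :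
    ((a * b) ^ p) x = x := by
  set A : Set α := Set.range fun i : ℤ => ((a * b) ^ i) x with hA
  have hax : a x = (a * b) (b x) := by rw [← Perm.mul_apply, mul_assoc, hb, mul_one]
  have haa : ∀ y, a (a y) = y := fun y => by rw [← Perm.mul_apply, ha, Perm.one_apply]
  have hbb : ∀ y, b (b y) = y := fun y => by rw [← Perm.mul_apply, hb, Perm.one_apply]
  have hbx : b x = ((a * b) ^ (-1 : ℤ)) (a x) := by rw [zpow_neg_one, Perm.eq_inv_iff_eq, hax]
  have hdisj : Disjoint A (a '' A) := by
    rw [Set.disjoint_left]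
    rintro _ ⟨i, rfl⟩ ⟨_, ⟨j, rfl⟩, hj⟩
    have h1 : a x = ((a * b) ^ (j + i)) x := by
      simp only at hj
      rw [zpow_add, Perm.mul_apply, ← hj, left_apply_zpow_mul ha hb, zpow_neg, Perm.inv_def, Equiv.apply_symm_apply]
    rcases Int.even_or_odd' (j + i) with ⟨m, hm | hm⟩
    · apply ha' (((a * b) ^ m) x)
      rw [left_apply_zpow_mul ha hb, h1, ← Perm.mul_apply, ← zpow_add, hm]
      congr 2
      ring
    · apply hb' (((a * b) ^ m) x)
      rw [right_apply_zpow_mul ha hb, hbx, h1, ← Perm.mul_apply, ← Perm.mul_apply, ← zpow_add,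
        ← zpow_add, hm]
      congr 2
      ring
  have hmem_a : a ∈ Subgroup.closure ({a, b} : Set (Perm α)) := Subgroup.subset_closure (by simp)
  have hmem_b : b ∈ Subgroup.closure ({a, b} : Set (Perm α)) := Subgroup.subset_closure (by simp)
  have horb : MulAction.orbit (Subgroup.closure ({a, b} : Set (Perm α))) x = A ∪ a '' A := by
    apply Set.Subset.antisymm
    · rintro _ ⟨⟨g, hg⟩, rfl⟩
      refine apply_mem_of_mem_closure (K := {a, b}) ?_ ?_ hg (Or.inl ⟨0, rfl⟩)
      · rintro k (rfl | rfl) <;> assumption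
      · rintro k (rfl | rfl)
        · rintro y (hy | ⟨z, hz, rfl⟩)
          · exact Or.inr ⟨y, hy, rfl⟩
          · rw [haa]; exact Or.inl hz
        · rintro y (⟨i, rfl⟩ | ⟨_, ⟨i, rfl⟩, rfl⟩)
          · refine Or.inr ⟨_, ⟨1 + i, rfl⟩, ?_⟩
            simp only [zpow_one_add, Perm.mul_apply, haa]
          · refine Or.inl ⟨-1 + i, ?_⟩
            simp only [zpow_add, zpow_neg_one, Perm.mul_apply, Perm.inv_eq_iff_eq, haa, hbb]
    · rintro _ (⟨i, rfl⟩ | ⟨_, ⟨i, rfl⟩, rfl⟩)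
      · exact ⟨⟨_, zpow_mem (mul_mem hmem_a hmem_b) i⟩, rfl⟩
      · exact ⟨⟨_, mul_mem hmem_a (zpow_mem (mul_mem hmem_a hmem_b) i)⟩, rfl⟩
  rw [Nat.card_coe_set_eq, horb, Set.ncard_union_eq hdisj,
    Set.ncard_image_of_injective _ a.injective, hA, card_orbit_zpowers] at hp
  have h := (zpow_apply_eq_iff (a * b) x p 0).2 (by
    rw [show Function.minimalPeriod (a * b) x = p by omega]; simp)
  simpa using h

/-- There are no three involutions of a seven-point set such that the first commutes with the
third and satisfies the braid relation with the second, while the last two generate a transitive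
group. -/
theorem false_of_card_eq_seven (hα : Nat.card α = 7) {s0 s1 s2 : Perm α}
    (h0 : s0 * s0 = 1) (h1 : s1 * s1 = 1) (h2 : s2 * s2 = 1) (h02 : s0 * s2 = s2 * s0)
    (h01 : s0 * s1 * s0 = s1 * s0 * s1)
    (htrans : ∀ S : Set α, S.Nonempty → (∀ y ∈ S, s1 y ∈ S) → (∀ y ∈ S, s2 y ∈ S) →
      S = Set.univ) : False := by
  have : Finite α := Nat.finite_of_card_ne_zero (by omega)
  have := Fintype.ofFinite α
  obtain ⟨v, hv⟩ : ∃ v, s2 v = v := by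
    have : Fact (Nat.Prime 2) := ⟨Nat.prime_two⟩
    refine Perm.exists_fixed_point_of_prime (p := 2) (n := 1) ?_ ?_
    · rw [← Nat.card_eq_fintype_card, hα]; norm_num
    · rw [pow_one, pow_two, h2]
  obtain ⟨u, hu⟩ : ∃ u : ℤ → α, u = fun i => ((s1 * s2) ^ i) v := ⟨_, rfl⟩
  have hu2 : ∀ i, s2 (u i) = u (-i) := fun i => by
    simp only [hu]; rw [right_apply_zpow_mul h1 h2, hv]
  have hu1 : ∀ i, s1 (u i) = u (1 - i) := fun i => by
    have hs : s1 (u i) = (s1 * s2) (s2 (u i)) := by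
      rw [← Perm.mul_apply, mul_assoc, h2, mul_one]
    rw [hs, hu2, sub_eq_add_neg]
    simp only [hu]
    rw [zpow_one_add, Perm.mul_apply (s1 * s2)]
  have hsurj : Set.range u = Set.univ := by
    refine htrans _ ⟨u 0, 0, rfl⟩ ?_ ?_
    · rintro _ ⟨i, rfl⟩; exact ⟨_, (hu1 i).symm⟩
    · rintro _ ⟨i, rfl⟩; exact ⟨_, (hu2 i).symm⟩
  have hper : Function.minimalPeriod (s1 * s2) v = 7 := by
    rw [← card_orbit_zpowers, ← hu, hsurj, Set.ncard_univ, hα]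
  have hinj : ∀ i j, u i = u j ↔ (7 : ℤ) ∣ i - j := fun i j => by
    rw [hu, zpow_apply_eq_iff, hper]; rfl
  have hex : ∀ y, ∃ k, u k = y := fun y => by
    rw [← Set.mem_range, hsurj]; trivial
  have hs0 : ∀ y, s0 (s0 y) = y := fun y => by rw [← Perm.mul_apply, h0, Perm.one_apply]
  have hc : ∀ y, s0 (s2 y) = s2 (s0 y) := fun y => congrArg (fun g : Perm α => g y) h02
  have hbr : ∀ y, s0 (s1 (s0 y)) = s1 (s0 (s1 y)) := fun y =>
    congrArg (fun g : Perm α => g y) h01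
  have f0 : s0 (u 0) = u 0 := by
    obtain ⟨k, hk⟩ := hex (s0 (u 0))
    have h := hc (u 0)
    rw [hu2, neg_zero, ← hk, hu2, hinj] at h
    rw [← hk, hinj]
    omega
  have f1 : s0 (u 1) = u 4 := by
    obtain ⟨k, hk⟩ := hex (s0 (u 1))
    have h := hbr (u 0)
    rw [f0, hu1, sub_zero, ← hk, hu1, hinj] at h
    rw [← hk, hinj]
    omega
  obtain ⟨k, hk⟩ := hex (s0 (u 2))
  have h := hbr (u 2)
  rw [hu1 2, show (1 - 2 : ℤ) = -1 by norm_num, ← hu2 1, hc, f1, hu2, hu1,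
    show (1 - -4 : ℤ) = 5 by norm_num] at h
  replace h := congrArg s0 h
  rw [hs0, (hinj 5 (-2)).2 (by norm_num), ← hu2 2, hc, ← hk, hu1, hu2, hinj] at h
  omega

end Involutions

namespace CMap

variable {F : Type} [Fintype F] (M : CMap F)

/-- The permutation of the automorphism orbits induced by an involution commuting with all
automorphisms. -/
def orbitPerm (s : Equiv.Perm F) (hs : s * s = 1) (hc : ∀ g ∈ M.aut, g * s = s * g) :
    Equiv.Perm (MulAction.orbitRel.Quotient M.aut F) :=
  Function.Involutive.toPerm
    (Quotient.map s (by
      rintro _ y ⟨⟨g, hg⟩, rfl⟩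
      exact ⟨⟨g, hg⟩, congrArg (fun h : Equiv.Perm F => h y) (hc g hg)⟩))
    (by
      rintro ⟨y⟩
      exact congrArg (Quotient.mk _) (congrArg (fun h : Equiv.Perm F => h y) hs))

theorem numFlagOrbits_eq_card_quotient :
    M.numFlagOrbits = Nat.card (MulAction.orbitRel.Quotient M.aut F) := by
  refine Nat.card_congr (Equiv.ofBijective
    (Quotient.lift (fun x => (⟨M.flagOrbit x, x, rfl⟩ : Set.range M.flagOrbit)) ?_) ⟨?_, ?_⟩).symm
  · exact fun x y h => Subtype.ext (MulAction.orbit_eq_iff.2 h)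
  · rintro ⟨x⟩ ⟨y⟩ h
    exact Quotient.sound (MulAction.orbit_eq_iff.1 (Subtype.ext_iff.1 h))
  · rintro ⟨_, x, rfl⟩
    exact ⟨Quotient.mk _ x, rfl⟩

end CMap

/-- There is no vertex-transitive equivelar map of Schläfli type
`{3, 7}` that is a `7`-orbit map. -/
theorem stmt_5 {F : Type} [Fintype F] (M : CMap F)
    (heq : M.Equivelar 3 7) (hvt : M.VertexTransitive) :
    ¬ M.IsKOrbit 7 := by
  intro h7
  have hcard := M.numFlagOrbits_eq_card_quotient.symm.trans h7
  have hc : ∀ s ∈ ({M.s0, M.s1, M.s2} : Set (Equiv.Perm F)), ∀ g ∈ M.aut, g * s = s * g :=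
    fun s hs g hg => (Subgroup.mem_centralizer_iff.1 hg s hs).symm
  have h02 : M.s0 * M.s2 = M.s2 * M.s0 := by
    rw [eq_inv_of_mul_eq_one_left M.invol02, mul_inv_rev, ← eq_inv_of_mul_eq_one_left M.invol0,
      ← eq_inv_of_mul_eq_one_left M.invol2]
  have h01 : M.s0 * M.s1 * M.s0 = M.s1 * M.s0 * M.s1 := by
    have h3 : (M.s0 * M.s1) ^ 3 = 1 := Equiv.ext fun x =>
      mul_pow_apply_eq_self M.invol0 M.invol1 M.fpf0 M.fpf1 (heq.1 x)
    have h : M.s0 * M.s1 * M.s0 * (M.s1 * M.s0 * M.s1) = 1 := by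
      rw [← h3]; simp only [pow_succ, pow_zero, one_mul, mul_assoc]
    rw [eq_inv_of_mul_eq_one_left h]
    simp only [mul_inv_rev, ← eq_inv_of_mul_eq_one_left M.invol0,
      ← eq_inv_of_mul_eq_one_left M.invol1, mul_assoc]
  refine false_of_card_eq_seven hcard
    (s0 := M.orbitPerm M.s0 M.invol0 (hc _ (by simp)))
    (s1 := M.orbitPerm M.s1 M.invol1 (hc _ (by simp)))
    (s2 := M.orbitPerm M.s2 M.invol2 (hc _ (by simp))) ?_ ?_ ?_ ?_ ?_ ?_
  · ext ⟨x⟩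
    exact congrArg (Quotient.mk _) (congrArg (fun h : Equiv.Perm F => h x) M.invol0)
  · ext ⟨x⟩
    exact congrArg (Quotient.mk _) (congrArg (fun h : Equiv.Perm F => h x) M.invol1)
  · ext ⟨x⟩
    exact congrArg (Quotient.mk _) (congrArg (fun h : Equiv.Perm F => h x) M.invol2)
  · ext ⟨x⟩
    exact congrArg (Quotient.mk _) (congrArg (fun h : Equiv.Perm F => h x) h02)
  · ext ⟨x⟩
    exact congrArg (Quotient.mk _) (congrArg (fun h : Equiv.Perm F => h x) h01)
  · rintro S ⟨⟨x⟩, hx⟩ hS1 hS2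
    rw [Set.eq_univ_iff_forall]
    rintro ⟨y⟩
    obtain ⟨g, hg, hgy⟩ := hvt x y
    have hy : y ∈ M.vertexOf (g x) := hgy ▸ MulAction.mem_orbit_self y
    obtain ⟨⟨k, hk⟩, rfl⟩ := hy
    refine apply_mem_of_mem_closure (K := {M.s1, M.s2})
      (S := {z : F | (Quotient.mk _ z : MulAction.orbitRel.Quotient M.aut F) ∈ S}) ?_ ?_ hk ?_
    · rintro k (rfl | rfl)
      exacts [M.invol1, M.invol2]
    · rintro k (rfl | rfl) z hz
      exacts [hS1 _ hz, hS2 _ hz]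
    · have hgx : (Quotient.mk _ (g x) : MulAction.orbitRel.Quotient M.aut F) = Quotient.mk _ x :=
        Quotient.sound ⟨⟨g, hg⟩, rfl⟩
      change Quotient.mk _ (g x) ∈ S
      rwa [hgx]
end
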